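/- For every real r > 0, writing k = k_r and α(r) = E(√(1−k²))/K(k) − π/(4·K(k)²), one has 1/π = √r·k·(1−k²)·[(2/π)²·K(k)·(E(k) − (1−k²)·K(k))/(k·(1−k²))] + (α(r) − √r·k²)·((2/π)·K(k))². -/

import Mathlib

open Real Filter

/-- The complete elliptic integral of the first kind. -/
noncomputable def EllipticK (k : ℝ) : ℝ :=
  ∫ θ in (0:ℝ)..(π / 2), 1 / Real.sqrt (1 - k ^ 2 * Real.sin θ ^ 2)

/-- The complete elliptic integral of the second kind. -/
noncomputable def EllipticE (k : ℝ) : ℝ :=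
  ∫ θ in (0:ℝ)..(π / 2), Real.sqrt (1 - k ^ 2 * Real.sin θ ^ 2)

/-- The one-variable Jacobi theta function `θ₂(q) = ∑_{n ∈ ℤ} q^((n + 1/2)²)`. -/
noncomputable def theta2 (q : ℝ) : ℝ := ∑' n : ℤ, q ^ (((n : ℝ) + 1 / 2) ^ 2)

/-- The one-variable Jacobi theta function `θ₃(q) = ∑_{n ∈ ℤ} q^(n²)`. -/
noncomputable def theta3 (q : ℝ) : ℝ := ∑' n : ℤ, q ^ ((n : ℝ) ^ 2)

/-- The singular value `k_r = λ*(r) = θ₂(q)²/θ₃(q)²` with `q = exp(−π√r)`. -/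
noncomputable def kSing (r : ℝ) : ℝ :=
  theta2 (Real.exp (-(π * Real.sqrt r))) ^ 2 / theta3 (Real.exp (-(π * Real.sqrt r))) ^ 2

/-- The Ramanujan g-invariant `g_r = ((1 − k_r²)/(2 k_r))^(1/12)`. -/
noncomputable def gRam (r : ℝ) : ℝ := ((1 - kSing r ^ 2) / (2 * kSing r)) ^ ((1 : ℝ) / 12)

/-- The singular value function of the second kind
`α(r) = E(√(1 − k_r²))/K(k_r) − π/(4·K(k_r)²)`. -/
noncomputable def alphaS (r : ℝ) : ℝ :=
  EllipticE (Real.sqrt (1 - kSing r ^ 2)) / EllipticK (kSing r) -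
    π / (4 * EllipticK (kSing r) ^ 2)

open Set MeasureTheory Topology

/-- Differentiation under the integral sign for an integrand that is `C¹` in the parameter,
jointly with the variable of integration. -/
lemma hasDerivAt_intervalIntegral_of_continuousOn {F F' : ℝ → ℝ → ℝ} {U : Set ℝ} (hU : IsOpen U)
    {x a b : ℝ} (hx : x ∈ U) (hF : ContinuousOn (Function.uncurry F) (U ×ˢ univ))
    (hF' : ContinuousOn (Function.uncurry F') (U ×ˢ univ))
    (hd : ∀ y ∈ U, ∀ t, HasDerivAt (fun z => F z t) (F' y t) y) :
    HasDerivAt (fun y => ∫ t in a..b, F y t) (∫ t in a..b, F' x t) x := by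
  have slice : ∀ {G : ℝ → ℝ → ℝ}, ContinuousOn (Function.uncurry G) (U ×ˢ univ) →
      ∀ y ∈ U, Continuous (G y) := by
    intro G hG y hy
    have h : Continuous (fun t : ℝ => (y, t)) := by fun_prop
    exact hG.comp_continuous h fun t => ⟨hy, mem_univ t⟩
  obtain ⟨ε, hε, hball⟩ := Metric.nhds_basis_closedBall.mem_iff.1 (hU.mem_nhds hx)
  obtain ⟨C, hC⟩ := ((isCompact_closedBall x ε).prod (isCompact_uIcc (a := a) (b := b))
    ).exists_bound_of_continuousOn (hF'.mono (prod_mono hball (subset_univ _)))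
  refine (intervalIntegral.hasDerivAt_integral_of_dominated_loc_of_deriv_le
    (s := Metric.closedBall x ε) (bound := fun _ => C) (Metric.closedBall_mem_nhds x hε)
    ?_ ((slice hF x hx).intervalIntegrable _ _) (slice hF' x hx).aestronglyMeasurable ?_
    (by simp) ?_).2
  · filter_upwards [hU.mem_nhds hx] with y hy using (slice hF y hy).aestronglyMeasurable
  · exact .of_forall fun t ht y hy => hC (y, t) ⟨hy, uIoc_subset_uIcc ht⟩
  · exact .of_forall fun t _ y hy => hd y (hball hy) t

/-- The complete elliptic integral of the first kind as a function of the parameter `m = k²`. -/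
noncomputable def ellK (m : ℝ) : ℝ := ∫ θ in (0:ℝ)..(π / 2), 1 / √(1 - m * sin θ ^ 2)

/-- The complete elliptic integral of the second kind as a function of the parameter `m = k²`. -/
noncomputable def ellE (m : ℝ) : ℝ := ∫ θ in (0:ℝ)..(π / 2), √(1 - m * sin θ ^ 2)

lemma one_sub_mul_sin_sq_pos {m : ℝ} (hm : m < 1) (θ : ℝ) : 0 < 1 - m * sin θ ^ 2 := by
  rcases le_total m 0 with h | h <;> nlinarith [sin_sq_le_one θ, sq_nonneg (sin θ)]

lemma continuous_one_div_sqrt {m : ℝ} (hm : m < 1) :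
    Continuous fun θ => 1 / √(1 - m * sin θ ^ 2) :=
  continuous_const.div (by fun_prop) fun θ => (sqrt_pos.2 (one_sub_mul_sin_sq_pos hm θ)).ne'

lemma continuous_one_div_sqrt_cube {m : ℝ} (hm : m < 1) :
    Continuous fun θ => 1 / √(1 - m * sin θ ^ 2) ^ 3 :=
  continuous_const.div (by fun_prop) fun θ =>
    (pow_pos (sqrt_pos.2 (one_sub_mul_sin_sq_pos hm θ)) 3).ne'

lemma continuous_ellE : Continuous ellE := by
  unfold ellE
  exact intervalIntegral.continuous_parametric_intervalIntegral_of_continuous' (by fun_prop) _ _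

lemma ellE_one : ellE 1 = 1 := by
  have h : ellE 1 = ∫ θ in (0:ℝ)..(π / 2), cos θ := by
    refine intervalIntegral.integral_congr fun θ hθ => ?_
    rw [uIcc_of_le (by positivity)] at hθ
    have : 1 - 1 * sin θ ^ 2 = cos θ ^ 2 := by rw [cos_sq']; ring
    simp only [this]
    exact sqrt_sq (cos_nonneg_of_mem_Icc ⟨by linarith [hθ.1, pi_pos], hθ.2⟩)
  rw [h, integral_cos]
  simp

/-- The integral of `Δ⁻³` in terms of the integral of the second kind. -/
lemma integral_one_div_sqrt_cube {m : ℝ} (hm : m < 1) :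
    (1 - m) * ∫ θ in (0:ℝ)..(π / 2), 1 / √(1 - m * sin θ ^ 2) ^ 3 = ellE m := by
  have hderiv : ∀ θ ∈ uIcc 0 (π / 2), HasDerivAt
      (fun θ => m * (sin θ * cos θ) / √(1 - m * sin θ ^ 2))
      (√(1 - m * sin θ ^ 2) - (1 - m) * (1 / √(1 - m * sin θ ^ 2) ^ 3)) θ := by
    intro θ _
    have hp := one_sub_mul_sin_sq_pos hm θ
    have hs := sqrt_pos.2 hp
    have h1 : HasDerivAt (fun θ => 1 - m * sin θ ^ 2) (-(m * (2 * sin θ * cos θ))) θ := by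
      simpa using (((hasDerivAt_sin θ).pow 2).const_mul m).const_sub 1
    have h2 := (((hasDerivAt_sin θ).mul (hasDerivAt_cos θ)).const_mul m).div
      (h1.sqrt hp.ne') hs.ne'
    refine h2.congr_deriv ?_
    have hsq : √(1 - m * sin θ ^ 2) ^ 2 = 1 - m * sin θ ^ 2 := sq_sqrt hp.le
    have hc := cos_sq' θ
    simp only [Pi.mul_apply]
    generalize √(1 - m * sin θ ^ 2) = d at *
    field_simp
    have hd4 : d ^ 4 = (1 - m * sin θ ^ 2) ^ 2 := by rw [← hsq]; ring
    rw [hd4, hsq]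
    have hs2 : sin θ ^ 2 = 1 - cos θ ^ 2 := by rw [hc]; ring
    rw [hs2]
    ring
  have hc1 : Continuous fun θ => √(1 - m * sin θ ^ 2) := by fun_prop
  have hc3 := (continuous_one_div_sqrt_cube hm).const_mul (1 - m)
  have h := intervalIntegral.integral_eq_sub_of_hasDerivAt hderiv
    ((hc1.sub hc3).intervalIntegrable _ _)
  rw [intervalIntegral.integral_sub (hc1.intervalIntegrable _ _) (hc3.intervalIntegrable _ _),
    intervalIntegral.integral_const_mul] at h
  simp only [sin_zero, cos_pi_div_two, mul_zero, zero_mul, zero_div, sub_self] at h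
  unfold ellE
  linarith

lemma hasDerivAt_ellE {m : ℝ} (hm0 : m ≠ 0) (hm : m < 1) :
    HasDerivAt ellE ((ellE m - ellK m) / (2 * m)) m := by
  have hpos : ∀ y ∈ Iio (1:ℝ), ∀ t, 0 < 1 - y * sin t ^ 2 :=
    fun y hy t => one_sub_mul_sin_sq_pos hy t
  have h := hasDerivAt_intervalIntegral_of_continuousOn (a := 0) (b := π / 2)
    (F := fun y t => √(1 - y * sin t ^ 2))
    (F' := fun y t => -sin t ^ 2 / (2 * √(1 - y * sin t ^ 2))) isOpen_Iio hm
    (by unfold Function.uncurry; fun_prop)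
    (by
      unfold Function.uncurry
      refine ContinuousOn.div (by fun_prop) (by fun_prop) ?_
      rintro ⟨y, t⟩ ⟨hy, _⟩
      exact (mul_pos two_pos (sqrt_pos.2 (hpos y hy t))).ne')
    (by
      intro y hy t
      have h1 : HasDerivAt (fun z => 1 - z * sin t ^ 2) (-sin t ^ 2) y := by
        simpa using ((hasDerivAt_id y).mul_const (sin t ^ 2)).const_sub 1
      exact h1.sqrt (hpos y hy t).ne')
  refine h.congr_deriv ?_
  have hc1 : Continuous fun θ => √(1 - m * sin θ ^ 2) := by fun_prop
  have hc3 := continuous_one_div_sqrt hm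
  unfold ellE ellK
  rw [← intervalIntegral.integral_sub (hc1.intervalIntegrable _ _) (hc3.intervalIntegrable _ _),
    ← intervalIntegral.integral_div]
  congr 1
  ext t
  have hp := hpos m hm t
  have hs := sqrt_pos.2 hp
  have hsq := sq_sqrt hp.le
  generalize √(1 - m * sin t ^ 2) = d at *
  field_simp
  rw [hsq]
  ring

lemma hasDerivAt_ellK {m : ℝ} (hm : m < 1) : HasDerivAt ellK
    (∫ θ in (0:ℝ)..(π / 2), sin θ ^ 2 / (2 * √(1 - m * sin θ ^ 2) ^ 3)) m := by
  have hpos : ∀ y ∈ Iio (1:ℝ), ∀ t, 0 < 1 - y * sin t ^ 2 :=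
    fun y hy t => one_sub_mul_sin_sq_pos hy t
  refine hasDerivAt_intervalIntegral_of_continuousOn (a := 0) (b := π / 2)
    (F := fun y t => 1 / √(1 - y * sin t ^ 2))
    (F' := fun y t => sin t ^ 2 / (2 * √(1 - y * sin t ^ 2) ^ 3)) isOpen_Iio hm ?_ ?_ ?_
  · unfold Function.uncurry
    refine ContinuousOn.div (by fun_prop) (by fun_prop) ?_
    rintro ⟨y, t⟩ ⟨hy, _⟩
    exact (sqrt_pos.2 (hpos y hy t)).ne'
  · unfold Function.uncurry
    refine ContinuousOn.div (by fun_prop) (by fun_prop) ?_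
    rintro ⟨y, t⟩ ⟨hy, _⟩
    exact (mul_pos two_pos (pow_pos (sqrt_pos.2 (hpos y hy t)) 3)).ne'
  · intro y hy t
    have hs := sqrt_pos.2 (hpos y hy t)
    have h1 : HasDerivAt (fun z => 1 - z * sin t ^ 2) (-sin t ^ 2) y := by
      simpa using ((hasDerivAt_id y).mul_const (sin t ^ 2)).const_sub 1
    have h2 := (h1.sqrt (hpos y hy t).ne').inv hs.ne'
    simp only [one_div]
    refine h2.congr_deriv ?_
    field_simp

lemma hasDerivAt_ellK_of_ne_zero {m : ℝ} (hm0 : m ≠ 0) (hm : m < 1) :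
    HasDerivAt ellK ((ellE m - (1 - m) * ellK m) / (2 * m * (1 - m))) m := by
  refine (hasDerivAt_ellK hm).congr_deriv ?_
  have hc1 := continuous_one_div_sqrt hm
  have hc3 := continuous_one_div_sqrt_cube hm
  have h1 : 1 - m ≠ 0 := by linarith
  rw [← integral_one_div_sqrt_cube hm, ← mul_sub]
  unfold ellK
  rw [← intervalIntegral.integral_sub (hc3.intervalIntegrable _ _) (hc1.intervalIntegrable _ _),
    mul_comm (1 - m), mul_div_mul_right _ _ h1, ← intervalIntegral.integral_div]
  congr 1
  ext t
  have hp := one_sub_mul_sin_sq_pos hm t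
  have hs := sqrt_pos.2 hp
  have hsq := sq_sqrt hp.le
  generalize √(1 - m * sin t ^ 2) = d at *
  field_simp
  rw [hsq]
  ring

lemma ellK_le {m : ℝ} (hm0 : 0 ≤ m) (hm : m < 1) : ellK m ≤ π / 2 / √(1 - m) := by
  have h : ellK m ≤ ∫ _ in (0:ℝ)..(π / 2), 1 / √(1 - m) := by
    refine intervalIntegral.integral_mono_on (by positivity)
      ((continuous_one_div_sqrt hm).intervalIntegrable _ _) (by simp) fun t _ => ?_
    have : 0 < √(1 - m) := sqrt_pos.2 (by linarith)
    gcongr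
    nlinarith [sin_sq_le_one t]
  refine h.trans_eq ?_
  simp [div_eq_mul_inv]

lemma ellK_pos {m : ℝ} (hm : m < 1) : 0 < ellK m :=
  intervalIntegral.intervalIntegral_pos_of_pos_on
    ((continuous_one_div_sqrt hm).intervalIntegrable _ _)
    (fun t _ => one_div_pos.2 (sqrt_pos.2 (one_sub_mul_sin_sq_pos hm t))) (by positivity)

lemma ellE_le_ellK {m : ℝ} (hm0 : 0 ≤ m) (hm : m < 1) : ellE m ≤ ellK m := by
  have hc1 : Continuous fun θ => √(1 - m * sin θ ^ 2) := by fun_prop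
  refine intervalIntegral.integral_mono_on (by positivity) (hc1.intervalIntegrable _ _)
    ((continuous_one_div_sqrt hm).intervalIntegrable _ _) fun t _ => ?_
  have hp := one_sub_mul_sin_sq_pos hm t
  rw [le_div_iff₀ (sqrt_pos.2 hp), mul_self_sqrt hp.le]
  nlinarith [sq_nonneg (sin t)]

lemma ellK_sub_ellE_le {m : ℝ} (hm0 : 0 ≤ m) (hm : m < 1) : ellK m - ellE m ≤ m * ellK m := by
  have hc1 : Continuous fun θ => √(1 - m * sin θ ^ 2) := by fun_prop
  have hc3 := continuous_one_div_sqrt hm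
  unfold ellK ellE
  rw [← intervalIntegral.integral_sub (hc3.intervalIntegrable _ _) (hc1.intervalIntegrable _ _),
    ← intervalIntegral.integral_const_mul]
  refine intervalIntegral.integral_mono_on (by positivity)
    ((hc3.sub hc1).intervalIntegrable _ _) ((hc3.const_mul m).intervalIntegrable _ _)
    fun t _ => ?_
  have hp := one_sub_mul_sin_sq_pos hm t
  have hs := sqrt_pos.2 hp
  rw [mul_one_div, sub_le_iff_le_add, ← sub_le_iff_le_add', ← sub_div, div_le_iff₀ hs,
    mul_self_sqrt hp.le]
  nlinarith [sin_sq_le_one t]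

/-- The left-hand side of Legendre's relation tends to `π / 2` as the parameter tends to `0`. -/
lemma tendsto_legendre : Tendsto (fun m => ellE (1 - m) * ellK m - (ellK m - ellE m) * ellK (1 - m))
    (𝓝[>] 0) (𝓝 (π / 2)) := by
  have hK : Tendsto ellK (𝓝[>] 0) (𝓝 (π / 2)) := by
    have h := (hasDerivAt_ellK one_pos).continuousAt.tendsto
    have h0 : ellK 0 = π / 2 := by simp [ellK]
    rw [h0] at h
    exact h.mono_left nhdsWithin_le_nhds
  have hE : Tendsto (fun m => ellE (1 - m)) (𝓝[>] 0) (𝓝 1) := by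
    have hc : Continuous fun m => ellE (1 - m) := continuous_ellE.comp (by fun_prop)
    have h := hc.tendsto 0
    rw [sub_zero, ellE_one] at h
    exact h.mono_left nhdsWithin_le_nhds
  have hmem : ∀ᶠ m : ℝ in 𝓝[>] 0, m ∈ Ioo (0:ℝ) 1 := Ioo_mem_nhdsGT one_pos
  have hprod : Tendsto (fun m => (ellK m - ellE m) * ellK (1 - m)) (𝓝[>] 0) (𝓝 0) := by
    have hbound : Tendsto (fun m => ellK m * (π / 2) * √m) (𝓝[>] 0) (𝓝 0) := by
      have hs : Tendsto (fun m : ℝ => √m) (𝓝[>] 0) (𝓝 0) := by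
        have := continuous_sqrt.tendsto 0
        rw [sqrt_zero] at this
        exact this.mono_left nhdsWithin_le_nhds
      simpa using (hK.mul_const (π / 2)).mul hs
    refine squeeze_zero' ?_ ?_ hbound
    · filter_upwards [hmem] with m hm
      exact mul_nonneg (sub_nonneg.2 (ellE_le_ellK hm.1.le hm.2))
        (ellK_pos (by linarith [hm.1])).le
    · filter_upwards [hmem] with m hm
      have hs : 0 < √m := sqrt_pos.2 hm.1
      have h1 := ellK_sub_ellE_le hm.1.le hm.2
      have h2 := ellK_le (m := 1 - m) (by linarith [hm.2]) (by linarith [hm.1])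
      rw [sub_sub_cancel] at h2
      have hKm := ellK_pos hm.2
      calc (ellK m - ellE m) * ellK (1 - m) ≤ (m * ellK m) * (π / 2 / √m) :=
            mul_le_mul h1 h2 (ellK_pos (by linarith [hm.1])).le (mul_pos hm.1 hKm).le
        _ = ellK m * (π / 2) * √m := by
            have := mul_self_sqrt hm.1.le
            field_simp
            rw [sq, this]
  simpa using (hE.mul hK).sub hprod

/-- Legendre's relation. -/
theorem legendre_relation {m : ℝ} (hm : m ∈ Ioo (0:ℝ) 1) :
    ellE (1 - m) * ellK m - (ellK m - ellE m) * ellK (1 - m) = π / 2 := by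
  have hderiv : ∀ x ∈ Ioo (0:ℝ) 1, HasDerivAt
      (fun m => ellE (1 - m) * ellK m - (ellK m - ellE m) * ellK (1 - m)) 0 x := by
    intro x hx
    have hx0 : x ≠ 0 := hx.1.ne'
    have hx1 : 1 - x ≠ 0 := by linarith [hx.2]
    have hlt : 1 - x < 1 := by linarith [hx.1]
    have hK := hasDerivAt_ellK_of_ne_zero hx0 hx.2
    have hE := hasDerivAt_ellE hx0 hx.2
    have hs : HasDerivAt (fun y : ℝ => 1 - y) (-1) x := by
      simpa using (hasDerivAt_id x).const_sub 1
    have hK' := (hasDerivAt_ellK_of_ne_zero hx1 hlt).comp x hs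
    have hE' := (hasDerivAt_ellE hx1 hlt).comp x hs
    refine ((hE'.mul hK).sub ((hK.sub hE).mul hK')).congr_deriv ?_
    simp only [Function.comp_apply, Pi.sub_apply, sub_sub_cancel]
    field_simp
    ring
  obtain ⟨c, hc⟩ := isOpen_Ioo.exists_is_const_of_deriv_eq_zero isPreconnected_Ioo
    (fun x hx => (hderiv x hx).differentiableAt.differentiableWithinAt)
    (fun x hx => (hderiv x hx).deriv)
  rw [hc m hm]
  have hmem : ∀ᶠ m : ℝ in 𝓝[>] 0, m ∈ Ioo (0:ℝ) 1 := Ioo_mem_nhdsGT one_pos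
  refine tendsto_nhds_unique (Tendsto.congr' ?_ tendsto_const_nhds) tendsto_legendre
  filter_upwards [hmem] with x hx using (hc x hx).symm

/-- Gauss's integral `∫₀^∞ dt / √((a² + t²)(b² + t²))`. -/
noncomputable def gaussIntegral (a b : ℝ) : ℝ :=
  ∫ t in Ioi (0:ℝ), 1 / √((a ^ 2 + t ^ 2) * (b ^ 2 + t ^ 2))

lemma ellK_eq_mul_gaussIntegral {a b : ℝ} (ha : 0 < a) (hb : 0 < b) :
    ellK (1 - (b / a) ^ 2) = a * gaussIntegral a b := by
  have hcos : ∀ θ ∈ Ioo (0:ℝ) (π / 2), 0 < cos θ := fun θ hθ =>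
    cos_pos_of_mem_Ioo ⟨by linarith [hθ.1, pi_pos], hθ.2⟩
  have himage : (fun θ => b * tan θ) '' Ioo 0 (π / 2) = Ioi 0 := by
    ext t
    constructor
    · rintro ⟨θ, hθ, rfl⟩
      exact mul_pos hb (tan_pos_of_pos_of_lt_pi_div_two hθ.1 hθ.2)
    · intro ht
      refine ⟨arctan (t / b), ⟨arctan_pos.2 (div_pos ht hb), arctan_lt_pi_div_two _⟩, ?_⟩
      simp only [tan_arctan]
      field_simp
  have hinj : InjOn (fun θ => b * tan θ) (Ioo 0 (π / 2)) := by
    intro x hx y hy hxy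
    refine tan_inj_of_lt_of_lt_pi_div_two ?_ hx.2 ?_ hy.2 (mul_left_cancel₀ hb.ne' hxy)
    · linarith [hx.1, pi_pos]
    · linarith [hy.1, pi_pos]
  have h := integral_image_eq_integral_abs_deriv_smul (f' := fun θ => b * (1 / cos θ ^ 2))
    measurableSet_Ioo
    (fun θ hθ => ((hasDerivAt_tan (hcos θ hθ).ne').const_mul b).hasDerivWithinAt) hinj
    (fun t => 1 / √((a ^ 2 + t ^ 2) * (b ^ 2 + t ^ 2)))
  rw [himage] at h
  rw [gaussIntegral, h, ellK, intervalIntegral.integral_of_le (by positivity),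
    integral_Ioc_eq_integral_Ioo, ← integral_const_mul]
  refine setIntegral_congr_fun measurableSet_Ioo fun θ hθ => ?_
  have hc := hcos θ hθ
  have hp : 0 < 1 - (1 - (b / a) ^ 2) * sin θ ^ 2 :=
    one_sub_mul_sin_sq_pos (by have := div_pos hb ha; nlinarith) θ
  have hs := sqrt_pos.2 hp
  have key : (a ^ 2 + (b * tan θ) ^ 2) * (b ^ 2 + (b * tan θ) ^ 2) =
      (1 - (1 - (b / a) ^ 2) * sin θ ^ 2) * (a * b / cos θ ^ 2) ^ 2 := by
    rw [tan_eq_sin_div_cos]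
    field_simp
    rw [sin_sq]
    ring
  simp only [smul_eq_mul]
  rw [key, sqrt_mul hp.le, sqrt_sq (by positivity), abs_of_pos (by positivity)]
  field_simp

/-- Gauss's integral is invariant under replacing its arguments by their arithmetic and geometric
means. -/
lemma gaussIntegral_agm {a b g : ℝ} (ha : 0 < a) (hb : 0 < b) (hg : g ^ 2 = a * b) :
    gaussIntegral ((a + b) / 2) g = gaussIntegral a b := by
  have hab : 0 < a * b := mul_pos ha hb
  have himage : (fun t => (t - a * b / t) / 2) '' Ioi 0 = univ := by
    refine eq_univ_of_forall fun u => ?_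
    have hsq : √(u ^ 2 + a * b) ^ 2 = u ^ 2 + a * b := sq_sqrt (by positivity)
    have hpos : 0 < u + √(u ^ 2 + a * b) := by
      have h : |u| < √(u ^ 2 + a * b) := by
        rw [← sqrt_sq_eq_abs]
        exact sqrt_lt_sqrt (sq_nonneg u) (by linarith)
      linarith [neg_abs_le u]
    refine ⟨u + √(u ^ 2 + a * b), hpos, ?_⟩
    generalize √(u ^ 2 + a * b) = w at *
    have : a * b = w ^ 2 - u ^ 2 := by linarith
    simp only [this]
    field_simp
    ring
  have hinj : InjOn (fun t => (t - a * b / t) / 2) (Ioi 0) := by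
    intro x hx y hy hxy
    have hx : 0 < x := hx
    have hy : 0 < y := hy
    have h : (x - y) * (x * y + a * b) = 0 := by
      simp only at hxy
      field_simp at hxy
      linarith
    have hne : x * y + a * b ≠ 0 := by positivity
    linarith [(mul_eq_zero.1 h).resolve_right hne]
  have hderiv : ∀ t ∈ Ioi (0:ℝ), HasDerivWithinAt (fun t => (t - a * b / t) / 2)
      ((1 + a * b / t ^ 2) / 2) (Ioi 0) t := by
    intro t ht
    have ht : t ≠ 0 := ne_of_gt ht
    have h := ((hasDerivAt_id t).sub ((hasDerivAt_inv ht).const_mul (a * b))).div_const 2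
    refine (h.congr_deriv ?_).hasDerivWithinAt
    field_simp
    ring
  have h := integral_image_eq_integral_abs_deriv_smul measurableSet_Ioi hderiv hinj
    (fun u => 1 / √((((a + b) / 2) ^ 2 + u ^ 2) * (g ^ 2 + u ^ 2)))
  rw [himage, setIntegral_univ] at h
  have habs := integral_comp_abs
    (f := fun u => 1 / √((((a + b) / 2) ^ 2 + u ^ 2) * (g ^ 2 + u ^ 2)))
  simp only [sq_abs] at habs
  rw [habs] at h
  have hright : ∫ t in Ioi (0:ℝ), |(1 + a * b / t ^ 2) / 2| •
      (1 / √((((a + b) / 2) ^ 2 + ((t - a * b / t) / 2) ^ 2) *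
        (g ^ 2 + ((t - a * b / t) / 2) ^ 2))) = 2 * gaussIntegral a b := by
    rw [gaussIntegral, ← integral_const_mul]
    refine setIntegral_congr_fun measurableSet_Ioi fun t ht => ?_
    have ht : 0 < t := ht
    have key : (((a + b) / 2) ^ 2 + ((t - a * b / t) / 2) ^ 2) *
        (g ^ 2 + ((t - a * b / t) / 2) ^ 2) =
        ((a ^ 2 + t ^ 2) * (b ^ 2 + t ^ 2)) * ((t ^ 2 + a * b) / (4 * t ^ 2)) ^ 2 := by
      rw [hg]
      field_simp
      ring
    simp only [smul_eq_mul]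
    rw [key, sqrt_mul (by positivity), sqrt_sq (by positivity), abs_of_pos (by positivity)]
    have hs : 0 < √((a ^ 2 + t ^ 2) * (b ^ 2 + t ^ 2)) := sqrt_pos.2 (by positivity)
    field_simp
    ring
  rw [hright] at h
  unfold gaussIntegral at h ⊢
  linarith

lemma pi_div_two_le_ellK {m : ℝ} (hm0 : 0 ≤ m) (hm : m < 1) : π / 2 ≤ ellK m := by
  have h : ∫ _ in (0:ℝ)..(π / 2), (1:ℝ) ≤ ellK m := by
    refine intervalIntegral.integral_mono_on (by positivity) (by simp)
      ((continuous_one_div_sqrt hm).intervalIntegrable _ _) fun t _ => ?_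
    rw [le_div_iff₀ (sqrt_pos.2 (one_sub_mul_sin_sq_pos hm t)), one_mul]
    refine sqrt_le_one.2 ?_
    nlinarith [sq_nonneg (sin t)]
  simpa using h

lemma tendsto_gaussIntegral {a b : ℕ → ℝ} (hb : ∀ n, 0 < b n) (hab : ∀ n, b n ≤ a n)
    (ha1 : Tendsto a atTop (𝓝 1)) (hb1 : Tendsto b atTop (𝓝 1)) :
    Tendsto (fun n => gaussIntegral (a n) (b n)) atTop (𝓝 (π / 2)) := by
  have hlow : Tendsto (fun n => π / 2 / a n) atTop (𝓝 (π / 2)) := by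
    simpa [div_eq_mul_inv] using (ha1.inv₀ one_ne_zero).const_mul (π / 2)
  have hup : Tendsto (fun n => π / 2 / b n) atTop (𝓝 (π / 2)) := by
    simpa [div_eq_mul_inv] using (hb1.inv₀ one_ne_zero).const_mul (π / 2)
  have hm : ∀ n, 0 ≤ 1 - (b n / a n) ^ 2 ∧ 1 - (b n / a n) ^ 2 < 1 := by
    intro n
    have ha := (hb n).trans_le (hab n)
    have h0 := div_pos (hb n) ha
    have h1 := (div_le_one ha).2 (hab n)
    constructor <;> nlinarith
  refine tendsto_of_tendsto_of_tendsto_of_le_of_le hlow hup (fun n => ?_) fun n => ?_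
  · have ha := (hb n).trans_le (hab n)
    have h := pi_div_two_le_ellK (hm n).1 (hm n).2
    rw [ellK_eq_mul_gaussIntegral ha (hb n)] at h
    rwa [div_le_iff₀' ha]
  · have ha := (hb n).trans_le (hab n)
    have h0 := div_pos (hb n) ha
    have h := ellK_le (hm n).1 (hm n).2
    rw [ellK_eq_mul_gaussIntegral ha (hb n), sub_sub_cancel, sqrt_sq h0.le] at h
    have hbn := hb n
    rw [le_div_iff₀ h0] at h
    rw [le_div_iff₀ hbn]
    calc gaussIntegral (a n) (b n) * b n = a n * gaussIntegral (a n) (b n) * (b n / a n) := by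
          field_simp
      _ ≤ π / 2 := h

/-- The theta series `∑ εⁿ exp(-π (n + a)² s)`; the values `(ε, a) = (1, 1/2), (1, 0), (-1, 0)`
give the theta functions `θ₂, θ₃, θ₄` at the nome `exp(-π s)`. -/
noncomputable def thetaSeries (ε : ℤˣ) (a s : ℝ) : ℝ :=
  ∑' n : ℤ, (((ε ^ n : ℤˣ) : ℤ) : ℝ) * exp (-π * (n + a) ^ 2 * s)

lemma summable_exp_neg_sq (a : ℝ) {s : ℝ} (hs : 0 < s) :
    Summable fun n : ℤ => exp (-π * (n + a) ^ 2 * s) := by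
  have h := HurwitzKernelBounds.summable_f_int 0 a hs
  unfold HurwitzKernelBounds.f_int at h
  simpa using h

lemma abs_intUnit (ε : ℤˣ) : |((ε : ℤ) : ℝ)| = 1 := by
  rcases Int.units_eq_one_or ε with rfl | rfl <;> simp

lemma summable_norm_thetaSeries (ε : ℤˣ) (a : ℝ) {s : ℝ} (hs : 0 < s) :
    Summable fun n : ℤ => ‖(((ε ^ n : ℤˣ) : ℤ) : ℝ) * exp (-π * (n + a) ^ 2 * s)‖ := by
  simpa [norm_mul, abs_intUnit] using summable_exp_neg_sq a hs

/-- The pairs of integers, split by the parity of their sum. -/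
lemma bijective_parity_split : Function.Bijective
    (Sum.elim (fun p : ℤ × ℤ => (p.1 + p.2, p.1 - p.2))
      (fun p : ℤ × ℤ => (p.1 + p.2 + 1, p.1 - p.2))) := by
  constructor
  · rintro (⟨a, b⟩ | ⟨a, b⟩) (⟨c, d⟩ | ⟨c, d⟩) h <;>
      simp only [Sum.elim_inl, Sum.elim_inr, Prod.mk.injEq] at h
    · obtain ⟨rfl, rfl⟩ : a = c ∧ b = d := by omega
      rfl
    · omega
    · omega
    · obtain ⟨rfl, rfl⟩ : a = c ∧ b = d := by omega
      rfl
  · rintro ⟨m, n⟩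
    rcases Int.even_or_odd' (m + n) with ⟨c, h | h⟩
    · exact ⟨.inl (c, m - c), by simp only [Sum.elim_inl, Prod.mk.injEq]; omega⟩
    · exact ⟨.inr (c, m - 1 - c), by simp only [Sum.elim_inr, Prod.mk.injEq]; omega⟩

lemma tsum_parity_split {F : ℤ × ℤ → ℝ} (hF : Summable F) :
    ∑' p, F p = ∑' p : ℤ × ℤ, F (p.1 + p.2, p.1 - p.2) +
      ∑' p : ℤ × ℤ, F (p.1 + p.2 + 1, p.1 - p.2) := by
  let e := Equiv.ofBijective _ bijective_parity_split
  have hs : Summable (F ∘ e) := e.summable_iff.2 hF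
  rw [← e.tsum_eq F]
  exact (HasSum.sum (hs.comp_injective Sum.inl_injective).hasSum
    (hs.comp_injective Sum.inr_injective).hasSum).tsum_eq

/-- The doubling formulas for products of theta functions. -/
lemma thetaSeries_mul_thetaSeries (ε δ : ℤˣ) {s : ℝ} (hs : 0 < s) :
    thetaSeries ε 0 s * thetaSeries δ 0 s =
      thetaSeries (ε * δ) 0 (2 * s) ^ 2 +
        ((ε : ℤ) : ℝ) * thetaSeries (ε * δ) (1 / 2) (2 * s) ^ 2 := by
  have h2s : 0 < 2 * s := by positivity
  have hε := summable_norm_thetaSeries ε 0 hs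
  have hδ := summable_norm_thetaSeries δ 0 hs
  have h0 := summable_norm_thetaSeries (ε * δ) 0 h2s
  have h1 := summable_norm_thetaSeries (ε * δ) (1 / 2) h2s
  have sign : ∀ m n : ℤ, ε ^ (m + n) * δ ^ (m - n) = (ε * δ) ^ m * (ε * δ) ^ n := by
    intro m n
    have hinv : δ⁻¹ = δ := Int.units_inv_eq_self δ
    rw [mul_zpow, mul_zpow, zpow_add, sub_eq_add_neg, zpow_add, zpow_neg, ← inv_zpow, hinv]
    exact mul_mul_mul_comm _ _ _ _
  unfold thetaSeries
  rw [sq, sq, tsum_mul_tsum_of_summable_norm hε hδ, tsum_mul_tsum_of_summable_norm h0 h0,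
    tsum_mul_tsum_of_summable_norm h1 h1, tsum_parity_split (summable_mul_of_summable_norm hε hδ),
    ← tsum_mul_left]
  have hsign : ∀ m n : ℤ, (((ε ^ (m + n) : ℤˣ) : ℤ) : ℝ) * (((δ ^ (m - n) : ℤˣ) : ℤ) : ℝ) =
      ((((ε * δ) ^ m : ℤˣ) : ℤ) : ℝ) * ((((ε * δ) ^ n : ℤˣ) : ℤ) : ℝ) := by
    intro m n
    exact_mod_cast congrArg (fun u : ℤˣ => (u : ℤ)) (sign m n)
  congr 1
  · refine tsum_congr fun ⟨m, n⟩ => ?_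
    have hexp : exp (-π * (((m + n : ℤ) : ℝ) + 0) ^ 2 * s) *
        exp (-π * (((m - n : ℤ) : ℝ) + 0) ^ 2 * s) =
        exp (-π * ((m : ℝ) + 0) ^ 2 * (2 * s)) * exp (-π * ((n : ℝ) + 0) ^ 2 * (2 * s)) := by
      rw [← exp_add, ← exp_add]
      congr 1
      push_cast
      ring
    dsimp only
    rw [mul_mul_mul_comm, hsign, hexp]
    ring
  · refine tsum_congr fun ⟨m, n⟩ => ?_
    have hexp : exp (-π * (((m + n + 1 : ℤ) : ℝ) + 0) ^ 2 * s) *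
        exp (-π * (((m - n : ℤ) : ℝ) + 0) ^ 2 * s) =
        exp (-π * ((m : ℝ) + 1 / 2) ^ 2 * (2 * s)) *
          exp (-π * ((n : ℝ) + 1 / 2) ^ 2 * (2 * s)) := by
      rw [← exp_add, ← exp_add]
      congr 1
      push_cast
      ring
    dsimp only
    rw [mul_mul_mul_comm, hexp, zpow_add_one, Units.val_mul, Int.cast_mul,
      mul_right_comm _ ((ε : ℤ) : ℝ), hsign]
    ring

lemma thetaSeries_neg_one_half (s : ℝ) : thetaSeries (-1) (1 / 2) s = 0 := by
  have h : thetaSeries (-1) (1 / 2) s = -thetaSeries (-1) (1 / 2) s := by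
    unfold thetaSeries
    rw [← tsum_neg, ← (Equiv.subLeft (-1 : ℤ)).tsum_eq]
    refine tsum_congr fun n => ?_
    have hsign : (-1 : ℤˣ) ^ (-1 - n) = -(-1) ^ n := by
      rw [zpow_sub, zpow_neg_one, Int.units_inv_eq_self, Int.units_inv_eq_self]
      simp
    simp only [Equiv.subLeft_apply, hsign, Units.val_neg, Int.cast_neg]
    rw [neg_mul]
    congr 3
    push_cast
    ring
  linarith

lemma thetaSeries_one_pos (a : ℝ) {s : ℝ} (hs : 0 < s) : 0 < thetaSeries 1 a s := by
  simp only [thetaSeries, one_zpow, Units.val_one, Int.cast_one, one_mul]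
  exact (summable_exp_neg_sq a hs).tsum_pos (fun n => (exp_pos _).le) 0 (exp_pos _)

/-- The modular transformation of `θ₃`. -/
lemma thetaSeries_one_inv {s : ℝ} (hs : 0 < s) :
    thetaSeries 1 0 s⁻¹ = √s * thetaSeries 1 0 s := by
  have h := Real.tsum_exp_neg_mul_int_sq hs
  rw [← sqrt_eq_rpow] at h
  have hpos := sqrt_pos.2 hs
  simp only [thetaSeries, one_zpow, Units.val_one, Int.cast_one, one_mul, add_zero]
  have e1 : ∀ n : ℤ, -π * (n:ℝ) ^ 2 * s = -π * s * (n:ℝ) ^ 2 := fun n => by ring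
  have e2 : ∀ n : ℤ, -π * (n:ℝ) ^ 2 * s⁻¹ = -π / s * (n:ℝ) ^ 2 := fun n => by ring
  simp only [e1, e2, h]
  field_simp

/-- The modular transformation exchanging `θ₂` and `θ₄`. -/
lemma thetaSeries_half_inv {s : ℝ} (hs : 0 < s) :
    thetaSeries 1 (1 / 2) s⁻¹ = √s * thetaSeries (-1) 0 s := by
  have h := Complex.tsum_exp_neg_quadratic (a := s) (by simpa using hs) (Complex.I / 2)
  have hl : ∀ n : ℤ, Complex.exp (-π * s * n ^ 2 + 2 * π * (Complex.I / 2) * n) =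
      (((((-1) ^ n : ℤˣ) : ℤ) : ℝ) * exp (-π * (n + 0) ^ 2 * s) : ℝ) := by
    intro n
    rw [add_comm, Complex.exp_add]
    have hpi : Complex.exp (2 * π * (Complex.I / 2) * n) = (-1) ^ n := by
      rw [← Complex.exp_pi_mul_I, ← Complex.exp_int_mul]
      congr 1
      ring
    rw [hpi]
    push_cast
    congr 2
    · rcases Int.even_or_odd n with hn | hn <;> simp [hn.neg_one_zpow]
    · ring
  have hr : ∀ n : ℤ, Complex.exp (-π / s * (n + Complex.I * (Complex.I / 2)) ^ 2) =
      (exp (-π * ((n:ℝ) - 1 / 2) ^ 2 * s⁻¹) : ℝ) := by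
    intro n
    push_cast
    congr 1
    have : Complex.I * (Complex.I / 2) = -(1 / 2) := by
      rw [← mul_div_assoc, Complex.I_mul_I]; ring
    rw [this]
    ring
  have hsqrt : ((s : ℂ) ^ (1 / 2 : ℂ)) = ((√s : ℝ) : ℂ) := by
    rw [sqrt_eq_rpow, Complex.ofReal_cpow hs.le]
    push_cast
    rfl
  simp only [hl, hr, hsqrt] at h
  rw [← Complex.ofReal_tsum, ← Complex.ofReal_tsum] at h
  have h' : thetaSeries (-1) 0 s = 1 / √s * ∑' n : ℤ, exp (-π * ((n:ℝ) - 1 / 2) ^ 2 * s⁻¹) := by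
    unfold thetaSeries
    exact_mod_cast h
  have hpos := sqrt_pos.2 hs
  rw [h', ← mul_assoc, mul_one_div_cancel hpos.ne', one_mul, ← (Equiv.addRight (1 : ℤ)).tsum_eq]
  simp only [thetaSeries, one_zpow, Units.val_one, Int.cast_one, one_mul]
  refine tsum_congr fun n => ?_
  congr 3
  simp only [Equiv.coe_addRight]
  push_cast
  ring

lemma thetaSeries_neg_one_pos {s : ℝ} (hs : 0 < s) : 0 < thetaSeries (-1) 0 s := by
  have h := thetaSeries_half_inv hs
  have hpos := thetaSeries_one_pos (1 / 2) (inv_pos.2 hs)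
  rw [h] at hpos
  exact pos_of_mul_pos_right hpos (sqrt_nonneg s)

lemma tendsto_thetaSeries (ε : ℤˣ) : Tendsto (thetaSeries ε 0) atTop (𝓝 1) := by
  have h := tendsto_tsum_of_dominated_convergence (𝓕 := atTop)
    (f := fun (s : ℝ) (n : ℤ) => (((ε ^ n : ℤˣ) : ℤ) : ℝ) * exp (-π * (n + 0) ^ 2 * s))
    (g := fun n : ℤ => if n = 0 then (1:ℝ) else 0) (summable_exp_neg_sq 0 one_pos) ?_ ?_
  · rw [tsum_ite_eq] at h
    exact h
  · intro n
    rcases eq_or_ne n 0 with rfl | hn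
    · simp
    · have hpos : 0 < π * ((n:ℝ) + 0) ^ 2 := by
        have : (n:ℝ) ≠ 0 := by exact_mod_cast hn
        rw [add_zero]
        positivity
      have hlim : Tendsto (fun s : ℝ => exp (-π * ((n:ℝ) + 0) ^ 2 * s)) atTop (𝓝 0) := by
        refine tendsto_exp_atBot.comp ?_
        have := tendsto_neg_atTop_atBot.comp (tendsto_id.const_mul_atTop hpos)
        refine this.congr fun s => ?_
        simp only [Function.comp_apply, id]
        ring
      simpa [hn] using hlim.const_mul (((ε ^ n : ℤˣ) : ℤ) : ℝ)
  · filter_upwards [eventually_ge_atTop 1] with s hs n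
    rw [norm_mul, norm_eq_abs, abs_intUnit, one_mul, norm_of_nonneg (exp_pos _).le]
    refine exp_le_exp.2 ?_
    have : 0 ≤ π * ((n:ℝ) + 0) ^ 2 := by positivity
    nlinarith

/-- `θ₃(q)² = θ₃(q²)² + θ₂(q²)²`. -/
lemma thetaSeries_one_sq {s : ℝ} (hs : 0 < s) : thetaSeries 1 0 s ^ 2 =
    thetaSeries 1 0 (2 * s) ^ 2 + thetaSeries 1 (1 / 2) (2 * s) ^ 2 := by
  simpa [sq] using thetaSeries_mul_thetaSeries 1 1 hs

/-- `θ₄(q)² = θ₃(q²)² - θ₂(q²)²`. -/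
lemma thetaSeries_neg_one_sq {s : ℝ} (hs : 0 < s) : thetaSeries (-1) 0 s ^ 2 =
    thetaSeries 1 0 (2 * s) ^ 2 - thetaSeries 1 (1 / 2) (2 * s) ^ 2 := by
  simpa [sq, sub_eq_add_neg] using thetaSeries_mul_thetaSeries (-1) (-1) hs

/-- `θ₃(q) θ₄(q) = θ₄(q²)²`. -/
lemma thetaSeries_one_mul_neg_one {s : ℝ} (hs : 0 < s) :
    thetaSeries 1 0 s * thetaSeries (-1) 0 s = thetaSeries (-1) 0 (2 * s) ^ 2 := by
  have h := thetaSeries_mul_thetaSeries 1 (-1) hs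
  rw [one_mul, thetaSeries_neg_one_half] at h
  simpa using h

/-- Jacobi's identity `θ₃⁴ = θ₂⁴ + θ₄⁴`. -/
lemma thetaSeries_jacobi {s : ℝ} (hs : 0 < s) : thetaSeries 1 0 s ^ 4 =
    thetaSeries 1 (1 / 2) s ^ 4 + thetaSeries (-1) 0 s ^ 4 := by
  have hs2 : 0 < s / 2 := by positivity
  have h3 := thetaSeries_one_sq hs2
  have h4 := thetaSeries_neg_one_sq hs2
  have h34 := thetaSeries_one_mul_neg_one hs2
  rw [mul_div_cancel₀ s two_ne_zero] at h3 h4 h34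
  have h : thetaSeries (-1) 0 s ^ 4 =
      thetaSeries 1 0 (s / 2) ^ 2 * thetaSeries (-1) 0 (s / 2) ^ 2 := by
    rw [← mul_pow, h34]; ring
  rw [h, h3, h4]
  ring

lemma gaussIntegral_thetaSeries {s : ℝ} (hs : 0 < s) :
    gaussIntegral (thetaSeries 1 0 s ^ 2) (thetaSeries (-1) 0 s ^ 2) = π / 2 := by
  have hpos : ∀ n : ℕ, 0 < 2 ^ n * s := fun n => by positivity
  have hinv : ∀ n : ℕ, gaussIntegral (thetaSeries 1 0 (2 ^ n * s) ^ 2)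
      (thetaSeries (-1) 0 (2 ^ n * s) ^ 2) =
      gaussIntegral (thetaSeries 1 0 s ^ 2) (thetaSeries (-1) 0 s ^ 2) := by
    intro n
    induction n with
    | zero => simp
    | succ n ih =>
      have h := hpos n
      rw [← ih, pow_succ' 2 n, mul_assoc, ← gaussIntegral_agm (pow_pos (thetaSeries_one_pos 0 h) 2)
        (pow_pos (thetaSeries_neg_one_pos h) 2) (g := thetaSeries (-1) 0 (2 * (2 ^ n * s)) ^ 2)
        (by rw [← thetaSeries_one_mul_neg_one h]; ring)]
      congr 1
      rw [thetaSeries_one_sq h, thetaSeries_neg_one_sq h]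
      ring
  have hlim : Tendsto (fun n : ℕ => 2 ^ n * s) atTop atTop :=
    (tendsto_pow_atTop_atTop_of_one_lt one_lt_two).atTop_mul_const hs
  have hone : ∀ ε : ℤˣ, Tendsto (fun n : ℕ => thetaSeries ε 0 (2 ^ n * s) ^ 2) atTop (𝓝 1) := by
    intro ε
    simpa using ((tendsto_thetaSeries ε).comp hlim).pow 2
  have h := tendsto_gaussIntegral (fun n => pow_pos (thetaSeries_neg_one_pos (hpos n)) 2)
    (fun n => by
      rw [thetaSeries_one_sq (hpos n), thetaSeries_neg_one_sq (hpos n)]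
      linarith [sq_nonneg (thetaSeries 1 (1 / 2) (2 * (2 ^ n * s)))]) (hone 1) (hone (-1))
  simp only [hinv] at h
  exact tendsto_nhds_unique tendsto_const_nhds h

/-- The complementary modulus of `θ₂²/θ₃²` is `θ₄²/θ₃²`. -/
lemma one_sub_modulus_sq {s : ℝ} (hs : 0 < s) :
    1 - (thetaSeries 1 (1 / 2) s ^ 2 / thetaSeries 1 0 s ^ 2) ^ 2 =
      (thetaSeries (-1) 0 s ^ 2 / thetaSeries 1 0 s ^ 2) ^ 2 := by
  have h3 := thetaSeries_one_pos 0 hs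
  have hj := thetaSeries_jacobi hs
  field_simp
  linarith

/-- Jacobi's inversion formula `K(θ₂²/θ₃²) = (π/2) θ₃²`. -/
lemma ellK_modulus {s : ℝ} (hs : 0 < s) :
    ellK ((thetaSeries 1 (1 / 2) s ^ 2 / thetaSeries 1 0 s ^ 2) ^ 2) =
      π / 2 * thetaSeries 1 0 s ^ 2 := by
  have h := ellK_eq_mul_gaussIntegral (pow_pos (thetaSeries_one_pos 0 hs) 2)
    (pow_pos (thetaSeries_neg_one_pos hs) 2)
  rw [gaussIntegral_thetaSeries hs, ← one_sub_modulus_sq hs, sub_sub_cancel] at h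
  rw [h, mul_comm]

/-- The complementary integral at the modulus `θ₂²/θ₃²`. -/
lemma ellK_one_sub_modulus {s : ℝ} (hs : 0 < s) :
    ellK (1 - (thetaSeries 1 (1 / 2) s ^ 2 / thetaSeries 1 0 s ^ 2) ^ 2) =
      s * ellK ((thetaSeries 1 (1 / 2) s ^ 2 / thetaSeries 1 0 s ^ 2) ^ 2) := by
  have h := ellK_modulus (inv_pos.2 hs)
  rw [thetaSeries_half_inv hs, thetaSeries_one_inv hs, mul_pow, mul_pow, sq_sqrt hs.le,
    mul_div_mul_left _ _ hs.ne', ← one_sub_modulus_sq hs] at h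
  rw [h, ellK_modulus hs]
  ring

lemma kSing_eq (r : ℝ) :
    kSing r = thetaSeries 1 (1 / 2) √r ^ 2 / thetaSeries 1 0 √r ^ 2 := by
  have h : ∀ x : ℝ, exp (-(π * √r)) ^ (x ^ 2) = exp (-π * x ^ 2 * √r) := by
    intro x
    rw [← exp_mul]
    ring_nf
  simp only [kSing, theta2, theta3, thetaSeries, h, one_zpow, Units.val_one, Int.cast_one, one_mul,
    add_zero]

/-- For every `r > 0`, writing `k = k_r`,
`1/π = √r·k·(1−k²)·[(2/π)²·K(k)·(E(k) − (1−k²)K(k))/(k(1−k²))]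
        + (α(r) − √r·k²)·((2/π)·K(k))²`. -/
theorem one_div_pi_eq (r : ℝ) (hr : 0 < r) :
    1 / π =
      Real.sqrt r * kSing r * (1 - kSing r ^ 2) *
        ((2 / π) ^ 2 * EllipticK (kSing r) *
          ((EllipticE (kSing r) - (1 - kSing r ^ 2) * EllipticK (kSing r)) /
            (kSing r * (1 - kSing r ^ 2)))) +
      (alphaS r - Real.sqrt r * kSing r ^ 2) * (2 / π * EllipticK (kSing r)) ^ 2 := by
  have hs := sqrt_pos.2 hr
  have h2 := thetaSeries_one_pos (1 / 2) hs
  have h3 := thetaSeries_one_pos 0 hs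
  have h4 := thetaSeries_neg_one_pos hs
  have hk : 0 < kSing r := by
    rw [kSing_eq]
    positivity
  have hk' : 0 < 1 - kSing r ^ 2 := by
    rw [kSing_eq, one_sub_modulus_sq hs]
    positivity
  have hK : EllipticK (kSing r) = ellK (kSing r ^ 2) := rfl
  have hE : EllipticE (kSing r) = ellE (kSing r ^ 2) := rfl
  have hE' : EllipticE √(1 - kSing r ^ 2) = ellE (1 - kSing r ^ 2) := by
    simp only [EllipticE, ellE, sq_sqrt hk'.le]
  have hratio : ellK (1 - kSing r ^ 2) = √r * ellK (kSing r ^ 2) := by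
    rw [kSing_eq]
    exact ellK_one_sub_modulus hs
  have hleg := legendre_relation (m := kSing r ^ 2) ⟨by positivity, by linarith⟩
  have hKpos : 0 < ellK (kSing r ^ 2) := ellK_pos (by linarith)
  rw [hratio] at hleg
  rw [alphaS, hE', hK, hE]
  generalize ellK (kSing r ^ 2) = K at *
  generalize ellE (kSing r ^ 2) = E at *
  generalize ellE (1 - kSing r ^ 2) = E' at *
  generalize √r = s at *
  generalize kSing r = k at *
  have hne := hk'.ne'
  have hpi := pi_pos
  field_simp
  linear_combination -16 * hleg
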